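/- Let S ⊆ ℝ^n be a nonempty set defined by finitely many polynomial equations, inequations and strict/non-strict inequalities with integer coefficients. Then S contains a point all of whose coordinates are real algebraic numbers. -/

import Mathlib

/-- Pseudo-division: after multiplication by a power of the leading coefficient of `p`, any
polynomial can be divided by `p` with remainder. -/
theorem Polynomial.exists_pow_leadingCoeff_mul_eq {R : Type*} [CommRing R] (p : Polynomial R)
    (hp : 0 < p.natDegree) (f : Polynomial R) :
    ∃ (N : ℕ) (q r : Polynomial R),
      C (p.leadingCoeff ^ N) * f = p * q + r ∧ r.natDegree < p.natDegree := by
  induction hd : f.natDegree using Nat.strong_induction_on generalizing f with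
  | _ d ih =>
    subst hd
    rcases lt_or_ge f.natDegree p.natDegree with h | h
    · exact ⟨0, 0, f, by simp, h⟩
    have hlt : (C p.leadingCoeff * f -
        p * (C f.leadingCoeff * X ^ (f.natDegree - p.natDegree))).natDegree < f.natDegree := by
      refine lt_of_le_of_ne ?_ fun heq => ?_
      · refine (natDegree_sub_le _ _).trans (max_le (natDegree_C_mul_le _ _) ?_)
        refine natDegree_mul_le.trans ?_
        have := natDegree_C_mul_X_pow_le f.leadingCoeff (f.natDegree - p.natDegree)
        omega
      · have hc : (C p.leadingCoeff * f -
            p * (C f.leadingCoeff * X ^ (f.natDegree - p.natDegree))).coeff f.natDegree = 0 := by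
          rw [← mul_assoc, coeff_sub, coeff_C_mul, coeff_mul_X_pow', if_pos (Nat.sub_le _ _),
            Nat.sub_sub_self h, coeff_mul_C]
          simp only [leadingCoeff]
          ring
        have hz := leadingCoeff_eq_zero.mp ((congrArg _ heq).trans hc)
        rw [hz, natDegree_zero] at heq
        omega
    obtain ⟨N, q, r, hqr, hr⟩ := ih _ hlt _ rfl
    refine ⟨N + 1, q + C (p.leadingCoeff ^ N) *
      (C f.leadingCoeff * X ^ (f.natDegree - p.natDegree)), r, ?_, hr⟩
    rw [pow_succ, C_mul]
    linear_combination hqr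

theorem MvPolynomial.aeval_cons {n : ℕ} {A : Type*} [CommRing A] (s : A) (y : Fin n → A)
    (f : MvPolynomial (Fin (n + 1)) ℤ) :
    aeval (Fin.cons s y : Fin (n + 1) → A) f =
      ((finSuccEquiv ℤ n f).map (aeval y : MvPolynomial (Fin n) ℤ →ₐ[ℤ] A).toRingHom).eval s := by
  induction f using MvPolynomial.induction_on with
  | C a => simp
  | add p q hp hq => simp [hp, hq]
  | mul_X p i hp =>
    rw [map_mul, map_mul, Polynomial.map_mul, Polynomial.eval_mul, hp, aeval_X]
    congr 1
    refine Fin.cases ?_ (fun j => ?_) i <;> simp [finSuccEquiv_X_zero, finSuccEquiv_X_succ]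

theorem MvPolynomial.continuous_aeval_real {n : ℕ} (f : MvPolynomial (Fin n) ℤ) :
    Continuous fun y : Fin n → ℝ => aeval y f := by
  induction f using MvPolynomial.induction_on with
  | C a => simpa using continuous_const
  | add p q hp hq => simpa only [map_add] using Continuous.fun_add hp hq
  | mul_X p i hp => simpa only [map_mul, aeval_X] using Continuous.fun_mul hp (continuous_apply i)

theorem MvPolynomial.continuous_eval_map_aeval {n : ℕ}
    (p : Polynomial (MvPolynomial (Fin n) ℤ)) (z : ℝ) :
    Continuous fun y : Fin n → ℝ =>
      (p.map (aeval y : MvPolynomial (Fin n) ℤ →ₐ[ℤ] ℝ).toRingHom).eval z := by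
  simp only [Polynomial.eval_map, Polynomial.eval₂_eq_sum_range]
  exact continuous_finsetSum _ fun i _ => (continuous_aeval_real _).mul continuous_const

theorem MvPolynomial.isAlgebraic_aeval {n : ℕ} {y : Fin n → ℝ} (hy : ∀ i, IsAlgebraic ℚ (y i))
    (f : MvPolynomial (Fin n) ℤ) : IsAlgebraic ℚ (aeval y f) := by
  induction f using MvPolynomial.induction_on with
  | C a => simpa using isAlgebraic_intCast (R := ℚ) (A := ℝ) a
  | add p q hp hq => simpa using hp.add hq
  | mul_X p i hp => simpa using hp.mul (hy i)

/-- A root of a nonzero polynomial with algebraic coefficients is algebraic. -/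
theorem Polynomial.isAlgebraic_of_eval_eq_zero {K L : Type*} [Field K] [Field L] [Algebra K L]
    {p : Polynomial L} (hp : p ≠ 0) (hcoeff : ∀ i, IsAlgebraic K (p.coeff i)) {z : L}
    (hz : p.eval z = 0) : IsAlgebraic K z := by
  have hlift : p ∈ lifts (algebraMap (algebraicClosure K L) L) :=
    (lifts_iff_coeff_lifts p).mpr fun i => ⟨⟨p.coeff i, mem_algebraicClosure_iff.mpr (hcoeff i)⟩, rfl⟩
  obtain ⟨q, rfl⟩ := (mem_lifts p).mp hlift
  have hq : IsAlgebraic (algebraicClosure K L) z :=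
    ⟨q, fun h => hp (by simp [h]), by rwa [eval_map_algebraMap] at hz⟩
  exact hq.restrictScalars K

open Filter Topology in
/-- Near a simple root, a real polynomial takes values of opposite signs on both sides. -/
theorem Polynomial.exists_eval_sub_lt_zero_lt_eval_add {p : Polynomial ℝ} {s : ℝ}
    (hs : p.eval s = 0) (hd : p.derivative.eval s ≠ 0) {ε : ℝ} (hε : 0 < ε) :
    ∃ δ, 0 < δ ∧ δ ≤ ε ∧ p.derivative.eval s * p.eval (s - δ) < 0 ∧
      0 < p.derivative.eval s * p.eval (s + δ) := by
  have hslope := ((p.hasDerivAt s).tendsto_slope.const_mul (p.derivative.eval s)).eventually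
    (lt_mem_nhds (mul_self_pos.mpr hd))
  rw [eventually_nhdsWithin_iff, Metric.eventually_nhds_iff] at hslope
  obtain ⟨η, hη, H⟩ := hslope
  have hδ : 0 < min ε (η / 2) := lt_min hε (by positivity)
  have hδη : min ε (η / 2) < η := (min_le_right _ _).trans_lt (by linarith)
  generalize hδdef : min ε (η / 2) = δ at hδ hδη
  refine ⟨δ, hδ, hδdef ▸ min_le_left _ _, ?_, ?_⟩
  · have h := @H (s - δ) (by simpa [Real.dist_eq, abs_of_pos hδ] using hδη) (by simp [hδ.ne'])
    rw [slope_def_field, hs, sub_zero, show s - δ - s = -δ by ring, ← mul_div_assoc, div_neg,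
      neg_pos] at h
    simpa [div_lt_iff₀ hδ] using h
  · have h := @H (s + δ) (by simpa [Real.dist_eq, abs_of_pos hδ] using hδη) (by simp [hδ.ne'])
    rw [slope_def_field, hs, sub_zero, add_sub_cancel_left, ← mul_div_assoc] at h
    simpa [lt_div_iff₀ hδ] using h

open Filter Topology in
/-- Real algebraic points are dense in every algebraic subset of `ℝⁿ` defined over `ℤ`. -/
theorem MvPolynomial.frequently_isAlgebraic_of_aeval_eq_zero {n : ℕ} (x : Fin n → ℝ)
    {F : Set (MvPolynomial (Fin n) ℤ)} (hF : F.Finite) (hx : ∀ f ∈ F, aeval x f = 0) :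
    ∃ᶠ y in 𝓝 x, (∀ i, IsAlgebraic ℚ (y i)) ∧ ∀ f ∈ F, aeval y f = 0 := by
  induction n with
  | zero =>
    refine Eventually.frequently (Eventually.of_forall fun y => ⟨fun i => i.elim0, ?_⟩)
    rwa [Subsingleton.elim y x]
  | succ n ih =>
    induction x using Fin.consCases with | _ s x
    simp only [aeval_cons] at hx
    let ev (y : Fin n → ℝ) : MvPolynomial (Fin n) ℤ →+* ℝ :=
      (aeval y : MvPolynomial (Fin n) ℤ →ₐ[ℤ] ℝ).toRingHom
    rw [Metric.nhds_basis_closedBall.frequently_iff]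
    intro ε hε
    suffices ∃ y ∈ Metric.closedBall x ε, ∃ z ∈ Metric.closedBall s ε,
        (∀ i, IsAlgebraic ℚ (y i)) ∧ IsAlgebraic ℚ z ∧
        ∀ f ∈ F, ((finSuccEquiv ℤ n f).map (ev y)).eval z = 0 by
      obtain ⟨y, hy, z, hz, hya, hza, hf⟩ := this
      refine ⟨Fin.cons z y, ?_, Fin.cases hza hya, fun f h => (aeval_cons z y f).trans (hf f h)⟩
      rw [Metric.mem_closedBall, dist_pi_le_iff hε.le] at hy ⊢
      exact Fin.cases hz hy
    have hball : ∀ᶠ y in 𝓝 x, y ∈ Metric.closedBall x ε := Metric.closedBall_mem_nhds x hε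
    by_cases hex : ∃ p : Polynomial (MvPolynomial (Fin n) ℤ),
        p.map (ev x) ≠ 0 ∧ (p.map (ev x)).eval s = 0
    · obtain ⟨p, ⟨hp0, hps⟩, hmin⟩ := exists_minimalFor_of_wellFoundedLT _ Polynomial.natDegree hex
      replace hmin : ∀ r : Polynomial (MvPolynomial (Fin n) ℤ), r.natDegree < p.natDegree →
          (r.map (ev x)).eval s = 0 → r.map (ev x) = 0 := by
        intro r hr hrs
        by_contra hr0
        exact hr.not_ge (hmin ⟨hr0, hrs⟩ hr.le)
      have hpos : 0 < p.natDegree := by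
        rw [Nat.pos_iff_ne_zero]
        intro h
        rw [Polynomial.eq_C_of_natDegree_eq_zero h] at hp0 hps
        simp only [Polynomial.map_C, Polynomial.eval_C] at hps
        simp [hps] at hp0
      have hlead : ev x p.leadingCoeff ≠ 0 := by
        intro h
        have herase : p.eraseLead.map (ev x) = p.map (ev x) := by
          conv_rhs => rw [← p.eraseLead_add_C_mul_X_pow]
          rw [Polynomial.map_add, Polynomial.map_mul, Polynomial.map_C, h, Polynomial.C_0,
            zero_mul, add_zero]
        refine hp0 (herase ▸ hmin _ ?_ (herase ▸ hps))
        exact (Polynomial.eraseLead_natDegree_le p).trans_lt (by omega)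
      have hderiv : (p.map (ev x)).derivative.eval s ≠ 0 := by
        intro h
        rw [Polynomial.derivative_map] at h
        have h0 := congrArg (Polynomial.coeff · (p.natDegree - 1))
          (hmin _ (Polynomial.natDegree_derivative_lt hpos.ne') h)
        simp only [Polynomial.coeff_map, Polynomial.coeff_derivative, Polynomial.coeff_zero,
          Nat.sub_add_cancel hpos, map_mul] at h0
        refine (mul_ne_zero hlead ?_) h0
        rw [← Nat.cast_add_one, Nat.sub_add_cancel hpos, map_natCast]
        exact_mod_cast hpos.ne'
      choose N q r hqr hr using p.exists_pow_leadingCoeff_mul_eq hpos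
      have hrem : ∀ f ∈ F, (r (finSuccEquiv ℤ n f)).map (ev x) = 0 := by
        intro f hf
        refine hmin _ (hr _) ?_
        have h := congrArg (fun g => (g.map (ev x)).eval s) (hqr (finSuccEquiv ℤ n f))
        simpa [hps, show ((finSuccEquiv ℤ n f).map (ev x)).eval s = 0 from hx f hf] using h.symm
      obtain ⟨δ, hδ, hδε, hneg, hposi⟩ :=
        Polynomial.exists_eval_sub_lt_zero_lt_eval_add hps hderiv hε
      have hG : (⋃ f ∈ F, ((r (finSuccEquiv ℤ n f)).coeffs : Set (MvPolynomial (Fin n) ℤ))).Finite :=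
        hF.biUnion fun f _ => Finset.finite_toSet _
      have hfreq := ih x hG (by
        simp only [Set.mem_iUnion, Finset.mem_coe, Polynomial.mem_coeffs_iff]
        rintro _ ⟨f, hf, i, -, rfl⟩
        simpa [ev] using congrArg (Polynomial.coeff · i) (hrem f hf))
      have hlead' : ∀ᶠ y in 𝓝 x, ev y p.leadingCoeff ≠ 0 :=
        (continuous_aeval_real p.leadingCoeff).continuousAt.eventually_ne hlead
      have hneg' := ((continuous_eval_map_aeval p (s - δ)).const_mul
        ((p.map (ev x)).derivative.eval s)).continuousAt.eventually (gt_mem_nhds hneg)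
      have hpos' := ((continuous_eval_map_aeval p (s + δ)).const_mul
        ((p.map (ev x)).derivative.eval s)).continuousAt.eventually (lt_mem_nhds hposi)
      obtain ⟨y, ⟨hya, hyG⟩, hyb, hyl, hyn, hyp⟩ := (hfreq.and_eventually
        (hball.and (hlead'.and (hneg'.and hpos')))).exists
      obtain ⟨z, hz, hz0⟩ := intermediate_value_Icc (by linarith : s - δ ≤ s + δ)
        ((p.map (ev y)).continuous.const_mul
          ((p.map (ev x)).derivative.eval s)).continuousOn ⟨hyn.le, hyp.le⟩
      replace hz0 : (p.map (ev y)).eval z = 0 := (mul_eq_zero.mp hz0).resolve_left hderiv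
      refine ⟨y, hyb, z, ?_, hya, ?_, fun f hf => ?_⟩
      · rw [Real.closedBall_eq_Icc]
        exact Set.Icc_subset_Icc (by linarith) (by linarith) hz
      · refine Polynomial.isAlgebraic_of_eval_eq_zero (p := p.map (ev y)) ?_ (fun i => ?_) hz0
        · intro h
          refine hyl ?_
          simpa using congrArg (Polynomial.coeff · p.natDegree) h
        · rw [Polynomial.coeff_map]
          exact isAlgebraic_aeval hya _
      · have hry : (r (finSuccEquiv ℤ n f)).map (ev y) = 0 := by
          ext i
          rw [Polynomial.coeff_map, Polynomial.coeff_zero]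
          by_cases hi : (r (finSuccEquiv ℤ n f)).coeff i = 0
          · rw [hi, map_zero]
          · exact hyG _ (Set.mem_biUnion hf (Polynomial.coeff_mem_coeffs hi))
        have h := congrArg (fun g => (g.map (ev y)).eval z) (hqr (finSuccEquiv ℤ n f))
        simpa [hz0, hry, hyl] using h
    · push Not at hex
      have hzero : ∀ f ∈ F, (finSuccEquiv ℤ n f).map (ev x) = 0 := fun f hf => by
        by_contra h
        exact hex _ h (hx f hf)
      have hG : (⋃ f ∈ F, ((finSuccEquiv ℤ n f).coeffs : Set (MvPolynomial (Fin n) ℤ))).Finite :=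
        hF.biUnion fun f _ => Finset.finite_toSet _
      have hfreq := ih x hG (by
        simp only [Set.mem_iUnion, Finset.mem_coe, Polynomial.mem_coeffs_iff]
        rintro _ ⟨f, hf, i, -, rfl⟩
        simpa [ev] using congrArg (Polynomial.coeff · i) (hzero f hf))
      obtain ⟨y, ⟨hya, hyG⟩, hyb⟩ := (hfreq.and_eventually hball).exists
      obtain ⟨z, hz1, hz2⟩ := exists_rat_btwn (lt_add_of_pos_right s hε)
      refine ⟨y, hyb, z, ?_, hya, isAlgebraic_algebraMap z, fun f hf => ?_⟩
      · rw [Real.closedBall_eq_Icc]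
        exact ⟨by linarith, hz2.le⟩
      · have hfy : (finSuccEquiv ℤ n f).map (ev y) = 0 := by
          ext i
          rw [Polynomial.coeff_map, Polynomial.coeff_zero]
          by_cases hi : (finSuccEquiv ℤ n f).coeff i = 0
          · rw [hi, map_zero]
          · exact hyG _ (Set.mem_biUnion hf (Polynomial.coeff_mem_coeffs hi))
        rw [hfy, Polynomial.eval_zero]

/-- a nonempty basic semialgebraic subset of `ℝⁿ` defined by
finitely many polynomial equations, inequations and (strict or non-strict)
inequalities with integer coefficients contains a point all of whose
coordinates are real algebraic numbers. -/
theorem basic_semialgebraic_has_algebraic_point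
    {n : ℕ}
    {ιeq ιne ιlt ιle ιge ιgt : Type*}
    [Finite ιeq] [Finite ιne] [Finite ιlt] [Finite ιle] [Finite ιge] [Finite ιgt]
    (feq : ιeq → MvPolynomial (Fin n) ℤ) (fne : ιne → MvPolynomial (Fin n) ℤ)
    (flt : ιlt → MvPolynomial (Fin n) ℤ) (fle : ιle → MvPolynomial (Fin n) ℤ)
    (fge : ιge → MvPolynomial (Fin n) ℤ) (fgt : ιgt → MvPolynomial (Fin n) ℤ)
    (x : Fin n → ℝ)
    (hxeq : ∀ i, MvPolynomial.aeval x (feq i) = 0)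
    (hxne : ∀ i, MvPolynomial.aeval x (fne i) ≠ 0)
    (hxlt : ∀ i, MvPolynomial.aeval x (flt i) < 0)
    (hxle : ∀ i, MvPolynomial.aeval x (fle i) ≤ 0)
    (hxge : ∀ i, 0 ≤ MvPolynomial.aeval x (fge i))
    (hxgt : ∀ i, 0 < MvPolynomial.aeval x (fgt i)) :
    ∃ y : Fin n → ℝ, (∀ i, IsAlgebraic ℚ (y i)) ∧
      (∀ i, MvPolynomial.aeval y (feq i) = 0) ∧
      (∀ i, MvPolynomial.aeval y (fne i) ≠ 0) ∧
      (∀ i, MvPolynomial.aeval y (flt i) < 0) ∧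
      (∀ i, MvPolynomial.aeval y (fle i) ≤ 0) ∧
      (∀ i, 0 ≤ MvPolynomial.aeval y (fge i)) ∧
      (∀ i, 0 < MvPolynomial.aeval y (fgt i)) := by
  have hF : (Set.range feq ∪ {f ∈ Set.range fle ∪ Set.range fge |
      MvPolynomial.aeval x f = 0}).Finite :=
    (Set.finite_range feq).union
      (((Set.finite_range fle).union (Set.finite_range fge)).subset (Set.sep_subset _ _))
  have hfreq := MvPolynomial.frequently_isAlgebraic_of_aeval_eq_zero x hF (by
    rintro f (⟨i, rfl⟩ | ⟨-, hf⟩)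
    exacts [hxeq i, hf])
  have hcont (f : MvPolynomial (Fin n) ℤ) :
      ContinuousAt (fun y : Fin n → ℝ => MvPolynomial.aeval y f) x :=
    f.continuous_aeval_real.continuousAt
  have hne := Filter.eventually_all.mpr fun i => (hcont (fne i)).eventually_ne (hxne i)
  have hlt := Filter.eventually_all.mpr fun i =>
    (hcont (flt i)).eventually (gt_mem_nhds (hxlt i))
  have hgt := Filter.eventually_all.mpr fun i =>
    (hcont (fgt i)).eventually (lt_mem_nhds (hxgt i))
  have hle := Filter.eventually_all.mpr fun i => Filter.eventually_imp_distrib_left.mpr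
    fun h : MvPolynomial.aeval x (fle i) < 0 => (hcont (fle i)).eventually (gt_mem_nhds h)
  have hge := Filter.eventually_all.mpr fun i => Filter.eventually_imp_distrib_left.mpr
    fun h : 0 < MvPolynomial.aeval x (fge i) => (hcont (fge i)).eventually (lt_mem_nhds h)
  obtain ⟨y, ⟨hya, hyF⟩, hyne, hylt, hygt, hyle, hyge⟩ := (hfreq.and_eventually
    (hne.and (hlt.and (hgt.and (hle.and hge))))).exists
  refine ⟨y, hya, fun i => hyF _ (.inl ⟨i, rfl⟩), hyne, hylt, fun i => ?_, fun i => ?_, hygt⟩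
  · rcases (hxle i).lt_or_eq with h | h
    · exact (hyle i h).le
    · exact (hyF _ (.inr ⟨.inl ⟨i, rfl⟩, h⟩)).le
  · rcases (hxge i).lt_or_eq with h | h
    · exact (hyge i h).le
    · exact (hyF _ (.inr ⟨.inr ⟨i, rfl⟩, h.symm⟩)).ge
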